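/- In the extremal Type II weight enumerator W*(X,Y) of length n = 3720 = 24·155, the third nonzero coefficient A*_{4(m+2)} (where m = ⌊n/24⌋) is negative. -/

import Mathlib

open MvPolynomial

/-- Gleason generator `f = X^8 + 14 X^4 Y^4 + Y^8` for Type II weight enumerators. -/
noncomputable def fII : MvPolynomial (Fin 2) ℝ := X 0 ^ 8 + 14 * X 0 ^ 4 * X 1 ^ 4 + X 1 ^ 8

/-- Gleason generator `g = X^4 Y^4 (X^4 - Y^4)^4` for Type II weight enumerators. -/
noncomputable def gII : MvPolynomial (Fin 2) ℝ := X 0 ^ 4 * X 1 ^ 4 * (X 0 ^ 4 - X 1 ^ 4) ^ 4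

/-- The coefficient of the monomial `X^a Y^b` in a two-variable polynomial. -/
noncomputable def coeffXY (P : MvPolynomial (Fin 2) ℝ) (a b : ℕ) : ℝ :=
  P.coeff (Finsupp.single 0 a + Finsupp.single 1 b)

/-- `P` is the extremal Type II weight enumerator of length `n`: a polynomial
`∑_{i=0}^{m} a_i f^(n/8-3i) g^i` (with `m = ⌊n/24⌋`) of the form
`X^n + ∑_{i=m+1}^{n/4} A*_{4i} X^(n-4i) Y^(4i)`. -/
def IsExtremalWE2 (n : ℕ) (P : MvPolynomial (Fin 2) ℝ) : Prop :=
  (∃ a : Fin (n / 24 + 1) → ℝ,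
    P = ∑ i : Fin (n / 24 + 1), C (a i) * fII ^ (n / 8 - 3 * (i : ℕ)) * gII ^ (i : ℕ)) ∧
  coeffXY P n 0 = 1 ∧
  ∀ i : ℕ, 1 ≤ i → i ≤ n / 24 → coeffXY P (n - 4 * i) (4 * i) = 0


namespace ExtAux

/-- `f` in the variable `x = Y^4` (with `X = 1`). -/
noncomputable def pf : Polynomial ℝ := 1 + 14 * Polynomial.X + Polynomial.X ^ 2

/-- `g` in the variable `x = Y^4` (with `X = 1`). -/
noncomputable def pg : Polynomial ℝ := Polynomial.X * (1 - Polynomial.X) ^ 4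

/-- Dehomogenisation `X ↦ 1`, `Y ↦ T`. -/
noncomputable def dehom : MvPolynomial (Fin 2) ℝ →ₐ[ℝ] Polynomial ℝ :=
  MvPolynomial.aeval ![1, Polynomial.X]

lemma dehom_f : dehom fII = Polynomial.expand ℝ 4 pf := by
  simp only [dehom, fII, pf, map_add, map_mul, map_pow, map_one, map_ofNat, aeval_X,
    Polynomial.expand_X, Matrix.cons_val_zero, Matrix.cons_val_one]
  ring

lemma dehom_g : dehom gII = Polynomial.expand ℝ 4 pg := by
  simp only [dehom, gII, pg, map_sub, map_mul, map_pow, map_one, aeval_X,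
    Polynomial.expand_X, Matrix.cons_val_zero, Matrix.cons_val_one]
  ring

lemma fII_hom : fII.IsHomogeneous 8 := by
  unfold fII
  have h14 : (14 : MvPolynomial (Fin 2) ℝ) = C 14 := (map_ofNat C 14).symm
  rw [h14]
  refine IsHomogeneous.add (IsHomogeneous.add (isHomogeneous_X_pow _ _) ?_)
    (isHomogeneous_X_pow _ _)
  have := ((isHomogeneous_C (Fin 2) (14 : ℝ)).mul (isHomogeneous_X_pow (R := ℝ) (0 : Fin 2) 4)).mul
    (isHomogeneous_X_pow (R := ℝ) (1 : Fin 2) 4)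
  simpa using this

lemma gII_hom : gII.IsHomogeneous 24 := by
  unfold gII
  exact ((isHomogeneous_X_pow (R := ℝ) (0 : Fin 2) 4).mul
    (isHomogeneous_X_pow (R := ℝ) (1 : Fin 2) 4)).mul
    (((isHomogeneous_X_pow (R := ℝ) (0 : Fin 2) 4).sub
    (isHomogeneous_X_pow (R := ℝ) (1 : Fin 2) 4)).pow 4)

lemma coeff_dehom {n : ℕ} (P : MvPolynomial (Fin 2) ℝ) (hP : P.IsHomogeneous n) (k : ℕ)
    (hk : k ≤ n) : (dehom P).coeff k = coeffXY P (n - k) k := by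
  unfold dehom coeffXY
  rw [aeval_def, eval₂_eq', Polynomial.finsetSum_coeff]
  have key : ∀ d ∈ P.support, d 0 + d 1 = n := by
    intro d hd
    have := hP (mem_support_iff.mp hd)
    simpa [Finsupp.weight_apply, Finsupp.sum_fintype] using this
  have e : ∀ d ∈ P.support, ((algebraMap ℝ (Polynomial ℝ)) (P.coeff d) *
      ∏ i : Fin 2, (![1, Polynomial.X] i : Polynomial ℝ) ^ d i).coeff k
      = if d = Finsupp.single 0 (n - k) + Finsupp.single 1 k then P.coeff d else 0 := by
    intro d hd
    have h1 := key d hd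
    have h2 : d = Finsupp.single 0 (n - k) + Finsupp.single 1 k ↔ k = d 1 := by
      constructor
      · intro h
        rw [h]; simp
      · intro h
        ext i
        fin_cases i
        · simp; omega
        · simp; omega
    simp only [h2]
    simp [Fin.prod_univ_two, Polynomial.coeff_X_pow, Polynomial.algebraMap_eq]
  rw [Finset.sum_congr rfl e, Finset.sum_ite_eq']
  split_ifs with h
  · rfl
  · exact (notMem_support_iff.mp h).symm

open PowerSeries in
/-- Power series version of `f`. -/
noncomputable def F : PowerSeries ℝ := 1 + 14 * PowerSeries.X + PowerSeries.X ^ 2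

/-- Numerator of the logarithmic derivative of the quotient of g by the cube of f. -/
noncomputable def N : PowerSeries ℝ :=
  1 - 33 * PowerSeries.X - 33 * PowerSeries.X ^ 2 + PowerSeries.X ^ 3

/-- `S = 1 / (1 - x)`. -/
noncomputable def S : PowerSeries ℝ := PowerSeries.mk 1

lemma S_mul : S * (1 - PowerSeries.X) = 1 := PowerSeries.mk_one_mul_one_sub_eq_one ℝ

lemma dS : PowerSeries.derivative ℝ S = S ^ 2 := by
  have h := congrArg (PowerSeries.derivative ℝ) S_mul
  rw [Derivation.leibniz, map_sub, PowerSeries.derivative_X] at h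
  simp only [smul_eq_mul, Derivation.map_one_eq_zero] at h
  have h1 := S_mul
  linear_combination S * h - (PowerSeries.derivative ℝ S - 0) * h1

lemma dF : PowerSeries.derivative ℝ F = 14 + 2 * PowerSeries.X := by
  unfold F
  have h14 : (14 : PowerSeries ℝ) = PowerSeries.C 14 :=
    (map_ofNat PowerSeries.C 14).symm
  rw [h14, map_add, map_add, Derivation.leibniz, PowerSeries.derivative_pow]
  simp [PowerSeries.derivative_X]

lemma coeff_X_deriv (U : PowerSeries ℝ) (j : ℕ) :
    PowerSeries.coeff (j + 1) (PowerSeries.X * PowerSeries.derivative ℝ U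
      - ((j + 1 : ℕ) : PowerSeries ℝ) * U) = 0 := by
  have h : ((j + 1 : ℕ) : PowerSeries ℝ) = PowerSeries.C ((j + 1 : ℕ) : ℝ) := by simp
  rw [h, map_sub, PowerSeries.coeff_succ_X_mul, PowerSeries.coeff_C_mul,
    PowerSeries.coeff_derivative]
  push_cast
  ring

lemma residue (l : ℕ) :
    PowerSeries.coeff (l + 1) (F ^ (3 * l + 2) * N * S ^ (4 * l + 5)) = 0 := by
  have h := coeff_X_deriv ((F ^ 3 * S ^ 4) ^ (l + 1)) l
  have e : PowerSeries.X * PowerSeries.derivative ℝ ((F ^ 3 * S ^ 4) ^ (l + 1))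
      - ((l + 1 : ℕ) : PowerSeries ℝ) * (F ^ 3 * S ^ 4) ^ (l + 1)
      = PowerSeries.C (-((l + 1 : ℕ) : ℝ)) * (F ^ (3 * l + 2) * N * S ^ (4 * l + 5)) := by
    have h1 : PowerSeries.X * PowerSeries.derivative ℝ (F ^ 3 * S ^ 4) - F ^ 3 * S ^ 4
        = - (F ^ 2 * N * S ^ 5) := by
      rw [Derivation.leibniz, PowerSeries.derivative_pow, PowerSeries.derivative_pow, dS, dF]
      simp only [smul_eq_mul]
      have h2 := S_mul
      have h3 : N = F * (1 - 5 * PowerSeries.X)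
          - 3 * PowerSeries.X * (1 - PowerSeries.X) * (14 + 2 * PowerSeries.X) := by
        unfold N F; ring
      rw [h3]
      push_cast
      linear_combination (F ^ 3 * S ^ 4 - 3 * F ^ 2 * S ^ 4 * PowerSeries.X *
        (14 + 2 * PowerSeries.X)) * h2
    rw [PowerSeries.derivative_pow, Nat.add_sub_cancel, map_neg, map_natCast]
    have e1 : F ^ (3 * l + 2) = (F ^ 3) ^ l * F ^ 2 := by rw [pow_add, pow_mul]
    have e2 : S ^ (4 * l + 5) = (S ^ 4) ^ l * S ^ 5 := by rw [pow_add, pow_mul]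
    rw [e1, e2, pow_succ (F ^ 3 * S ^ 4) l, mul_pow]
    linear_combination (((l + 1 : ℕ) : PowerSeries ℝ) * ((F ^ 3) ^ l * (S ^ 4) ^ l)) * h1
  rw [e, PowerSeries.coeff_C_mul] at h
  rcases mul_eq_zero.mp h with h | h
  · exfalso
    have : ((l + 1 : ℕ) : ℝ) = 0 := by linarith
    exact absurd this (by exact_mod_cast Nat.succ_ne_zero l)
  · exact h

lemma residue_term (K i : ℕ) (hK : 156 ≤ K) (hi : i ≤ 155) :
    PowerSeries.coeff K ((F ^ (465 - 3 * i) * (PowerSeries.X * (1 - PowerSeries.X) ^ 4) ^ i)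
      * (F ^ (3 * K - 466) * N * S ^ (4 * K + 1))) = 0 := by
  obtain ⟨l, rfl⟩ : ∃ l, K = (l + 1) + i := ⟨K - i - 1, by omega⟩
  have hs : (1 - PowerSeries.X) ^ (4 * i) * S ^ (4 * i) = 1 := by
    rw [← mul_pow, mul_comm, S_mul, one_pow]
  have e : (F ^ (465 - 3 * i) * (PowerSeries.X * (1 - PowerSeries.X) ^ 4) ^ i)
      * (F ^ (3 * (l + 1 + i) - 466) * N * S ^ (4 * (l + 1 + i) + 1))
      = PowerSeries.X ^ i * (F ^ (3 * l + 2) * N * S ^ (4 * l + 5)) := by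
    have e1 : 3 * l + 2 = (465 - 3 * i) + (3 * (l + 1 + i) - 466) := by omega
    have e2 : 4 * (l + 1 + i) + 1 = 4 * i + (4 * l + 5) := by ring
    rw [e1, e2, pow_add, pow_add S, mul_pow, ← pow_mul]
    linear_combination (PowerSeries.X ^ i * F ^ (465 - 3 * i) * F ^ (3 * (l + 1 + i) - 466) * N *
      S ^ (4 * l + 5)) * hs
  rw [e, PowerSeries.coeff_X_pow_mul]
  exact residue l

lemma coeff_S_pow (d n : ℕ) : PowerSeries.coeff n (S ^ (d + 1)) = ((d + n).choose d : ℝ) := by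
  unfold S
  rw [PowerSeries.mk_one_pow_eq_mk_choose_add, PowerSeries.coeff_mk]

lemma coeff_lit (c : ℝ) (k n : ℕ) (G : PowerSeries ℝ) :
    PowerSeries.coeff n (PowerSeries.C c * PowerSeries.X ^ k * G)
      = if k ≤ n then c * PowerSeries.coeff (n - k) G else 0 := by
  rw [mul_assoc, PowerSeries.coeff_C_mul, PowerSeries.coeff_X_pow_mul']
  split_ifs <;> simp

lemma H2_eq (G : PowerSeries ℝ) : F ^ 2 * N * G =
    PowerSeries.C 1 * PowerSeries.X ^ 0 * G
      + PowerSeries.C (-5) * PowerSeries.X ^ 1 * G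
      + PowerSeries.C (-759) * PowerSeries.X ^ 2 * G
      + PowerSeries.C (-7429) * PowerSeries.X ^ 3 * G
      + PowerSeries.C (-7429) * PowerSeries.X ^ 4 * G
      + PowerSeries.C (-759) * PowerSeries.X ^ 5 * G
      + PowerSeries.C (-5) * PowerSeries.X ^ 6 * G
      + PowerSeries.C 1 * PowerSeries.X ^ 7 * G := by
  simp only [map_neg, map_ofNat, map_one]
  unfold F N
  ring

lemma H5_eq (G : PowerSeries ℝ) : F ^ 5 * N * G =
    PowerSeries.C 1 * PowerSeries.X ^ 0 * G
      + PowerSeries.C 37 * PowerSeries.X ^ 1 * G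
      + PowerSeries.C (-378) * PowerSeries.X ^ 2 * G
      + PowerSeries.C (-39434) * PowerSeries.X ^ 3 * G
      + PowerSeries.C (-781565) * PowerSeries.X ^ 4 * G
      + PowerSeries.C (-6852681) * PowerSeries.X ^ 5 * G
      + PowerSeries.C (-25880412) * PowerSeries.X ^ 6 * G
      + PowerSeries.C (-25880412) * PowerSeries.X ^ 7 * G
      + PowerSeries.C (-6852681) * PowerSeries.X ^ 8 * G
      + PowerSeries.C (-781565) * PowerSeries.X ^ 9 * G
      + PowerSeries.C (-39434) * PowerSeries.X ^ 10 * G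
      + PowerSeries.C (-378) * PowerSeries.X ^ 11 * G
      + PowerSeries.C 37 * PowerSeries.X ^ 12 * G
      + PowerSeries.C 1 * PowerSeries.X ^ 13 * G := by
  simp only [map_neg, map_ofNat, map_one]
  unfold F N
  ring

/-- A quickly computable form of the binomial coefficient `(d + n).choose d`. -/
def Q (d n : ℕ) : ℕ := (d + n).descFactorial n / n.factorial

lemma choose_eq_Q (d n : ℕ) : (d + n).choose d = Q d n := by
  rw [Q, Nat.choose_symm_add, Nat.choose_eq_descFactorial_div_factorial]

lemma key : 666 * ((1) * (Q 624 156 : ℤ)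
      + (-5) * (Q 624 155 : ℤ)
      + (-759) * (Q 624 154 : ℤ)
      + (-7429) * (Q 624 153 : ℤ)
      + (-7429) * (Q 624 152 : ℤ)
      + (-759) * (Q 624 151 : ℤ)
      + (-5) * (Q 624 150 : ℤ)
      + (1) * (Q 624 149 : ℤ) : ℤ) <
    (1) * (Q 628 157 : ℤ)
      + (37) * (Q 628 156 : ℤ)
      + (-378) * (Q 628 155 : ℤ)
      + (-39434) * (Q 628 154 : ℤ)
      + (-781565) * (Q 628 153 : ℤ)
      + (-6852681) * (Q 628 152 : ℤ)
      + (-25880412) * (Q 628 151 : ℤ)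
      + (-25880412) * (Q 628 150 : ℤ)
      + (-6852681) * (Q 628 149 : ℤ)
      + (-781565) * (Q 628 148 : ℤ)
      + (-39434) * (Q 628 147 : ℤ)
      + (-378) * (Q 628 146 : ℤ)
      + (37) * (Q 628 145 : ℤ)
      + (1) * (Q 628 144 : ℤ) := by
  decide +kernel

lemma H2_0 : PowerSeries.coeff 0 (F ^ 2 * N * S ^ 625) = 1 := by
  rw [H2_eq]
  simp only [map_add, coeff_lit, coeff_S_pow]
  norm_num

lemma H5_0 : PowerSeries.coeff 0 (F ^ 5 * N * S ^ 629) = 1 := by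
  rw [H5_eq]
  simp only [map_add, coeff_lit, coeff_S_pow]
  norm_num

lemma H5_1 : PowerSeries.coeff 1 (F ^ 5 * N * S ^ 629) = 666 := by
  rw [H5_eq]
  simp only [map_add, coeff_lit, coeff_S_pow]
  norm_num

lemma numeric : 666 * PowerSeries.coeff 156 (F ^ 2 * N * S ^ 625)
    < PowerSeries.coeff 157 (F ^ 5 * N * S ^ 629) := by
  rw [H2_eq, H5_eq]
  simp only [map_add, coeff_lit, coeff_S_pow, choose_eq_Q, Nat.reduceLeDiff, if_true, Nat.reduceSub]
  have h := (Int.cast_lt (R := ℝ)).mpr key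
  push_cast at h
  linarith

end ExtAux

/-- For `n = 3720 = 24·155` (so `m = 155`), the third nonzero coefficient
`A*_{4(m+2)} = A*_{628}`, i.e. the coefficient of `X^(3720-628) Y^628`, in the
extremal Type II weight enumerator is negative (Zhang's theorem, instance `i = 155`). -/
theorem extremalWE2_3720_third_coeff_neg (P : MvPolynomial (Fin 2) ℝ)
    (hP : IsExtremalWE2 3720 P) :
    coeffXY P (3720 - 4 * (3720 / 24 + 2)) (4 * (3720 / 24 + 2)) < 0 := by
  open ExtAux in
  obtain ⟨⟨a, ha⟩, h0, hz⟩ := hP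
  change Fin 156 → ℝ at a
  replace ha : P = ∑ i : Fin 156, C (a i) * fII ^ (465 - 3 * (i : ℕ)) * gII ^ (i : ℕ) := ha
  replace hz : ∀ i : ℕ, 1 ≤ i → i ≤ 155 → coeffXY P (3720 - 4 * i) (4 * i) = 0 := hz
  change coeffXY P 3092 628 < 0
  have hom : P.IsHomogeneous 3720 := by
    rw [ha]
    refine IsHomogeneous.sum _ _ _ fun i _ => ?_
    have hi := i.2
    have := ((isHomogeneous_C (Fin 2) (a i)).mul (fII_hom.pow (465 - 3 * (i : ℕ)))).mul
      (gII_hom.pow (i : ℕ))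
    convert this using 1
    omega
  set w : Polynomial ℝ := ∑ i : Fin 156, Polynomial.C (a i) * pf ^ (465 - 3 * (i : ℕ)) *
    pg ^ (i : ℕ) with hw
  have hdw : dehom P = Polynomial.expand ℝ 4 w := by
    rw [ha, hw, map_sum, map_sum]
    refine Finset.sum_congr rfl fun i _ => ?_
    rw [map_mul, map_mul, map_pow, map_pow, dehom_f, dehom_g, map_mul, map_mul, map_pow, map_pow,
      Polynomial.expand_C]
    have hC : dehom (C (a i)) = Polynomial.C (a i) := by
      rw [dehom, aeval_C, Polynomial.algebraMap_eq]
    rw [hC]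
  have hc : ∀ k ≤ 930, coeffXY P (3720 - 4 * k) (4 * k) = w.coeff k := by
    intro k hk
    rw [← coeff_dehom P hom _ (by omega), hdw, Polynomial.coeff_expand_mul' (by norm_num)]
  have hww : (w : PowerSeries ℝ) = ∑ i : Fin 156, PowerSeries.C (a i) *
      (F ^ (465 - 3 * (i : ℕ)) * (PowerSeries.X * (1 - PowerSeries.X) ^ 4) ^ (i : ℕ)) := by
    have hf : (pf : PowerSeries ℝ) = F := by
      have h14 : (14 : Polynomial ℝ) = Polynomial.C 14 :=
        (map_ofNat Polynomial.C 14).symm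
      have h15 : (PowerSeries.C 14 : PowerSeries ℝ) = 14 := map_ofNat PowerSeries.C 14
      unfold pf F; rw [h14]; simp [h15]
    have hg : (pg : PowerSeries ℝ) = PowerSeries.X * (1 - PowerSeries.X) ^ 4 := by
      unfold pg; simp
    rw [hw, ← Polynomial.coeToPowerSeries.ringHom_apply, map_sum]
    refine Finset.sum_congr rfl fun i _ => ?_
    simp only [map_mul, map_pow, Polynomial.coeToPowerSeries.ringHom_apply, hf, hg,
      Polynomial.coe_C]
    ring
  have hres : ∀ K, 156 ≤ K → PowerSeries.coeff K ((w : PowerSeries ℝ) *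
      (F ^ (3 * K - 466) * N * S ^ (4 * K + 1))) = 0 := by
    intro K hK
    rw [hww, Finset.sum_mul, map_sum]
    refine Finset.sum_eq_zero fun i _ => ?_
    rw [mul_assoc, PowerSeries.coeff_C_mul, residue_term K i hK (by omega), mul_zero]
  have hdvd : (PowerSeries.X : PowerSeries ℝ) ^ 156 ∣ (w : PowerSeries ℝ) - 1 := by
    rw [PowerSeries.X_pow_dvd_iff]
    intro m hm
    rw [map_sub, Polynomial.coeff_coe, ← hc m (by omega), PowerSeries.coeff_one]
    split_ifs with h
    · subst h; simpa [sub_eq_zero] using h0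
    · rw [hz m (by omega) (by omega), sub_zero]
  obtain ⟨r, hr⟩ := hdvd
  have hwr : (w : PowerSeries ℝ) = 1 + PowerSeries.X ^ 156 * r := by rw [← hr]; ring
  have hgoal : coeffXY P 3092 628 = PowerSeries.coeff 1 r := by
    have h1 := hc 157 (by norm_num)
    have h2 := PowerSeries.coeff_X_pow_mul r 156 1
    rw [← hr, map_sub, Polynomial.coeff_coe, PowerSeries.coeff_one] at h2
    norm_num at h1 h2
    rw [h1, h2]
  have hK : ∀ t, PowerSeries.coeff (t + 156) (F ^ (3 * (t + 156) - 466) * N *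
      S ^ (4 * (t + 156) + 1)) + PowerSeries.coeff t (r * (F ^ (3 * (t + 156) - 466) * N *
      S ^ (4 * (t + 156) + 1))) = 0 := by
    intro t
    have h1 := hres (t + 156) (by omega)
    rwa [hwr, add_mul, one_mul, map_add, mul_assoc (PowerSeries.X ^ 156) r,
      PowerSeries.coeff_X_pow_mul] at h1
  have k0 := hK 0
  have k1 := hK 1
  norm_num only [] at k0 k1
  rw [PowerSeries.coeff_mul (φ := r)] at k0 k1
  rw [Finset.Nat.antidiagonal_zero, Finset.sum_singleton, H2_0] at k0
  rw [Finset.Nat.sum_antidiagonal_eq_sum_range_succ_mk] at k1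
  simp only [Finset.sum_range_succ, Finset.sum_range_zero, Nat.sub_zero, Nat.sub_self,
    H5_0, H5_1] at k1
  have := numeric
  rw [hgoal]
  linarith
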